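/- Let C be an [n,2,d] antipodal two-weight rank metric code over F_{q^m}/F_q. Then 2d ≥ n, i.e. the minimum rank distance d is at least n/2. -/

import Mathlib

/-- The rank (over the base field `K`) of a vector `c ∈ L^n`. -/
noncomputable def rankWeight (K : Type*) [Field K] {L : Type*} [Field L] [Algebra K L]
    {n : ℕ} (c : Fin n → L) : ℕ :=
  Module.finrank K (Submodule.span K (Set.range c))

theorem rankWeight_smul_le (K : Type*) [Field K] {L : Type*} [Field L] [Algebra K L]
    {n : ℕ} (a : L) (c : Fin n → L) : rankWeight K (a • c) ≤ rankWeight K c := by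
  have h : Submodule.span K (Set.range (a • c)) =
      (Submodule.span K (Set.range c)).map (LinearMap.mulLeft K a) := by
    rw [Submodule.map_span, ← Set.range_comp]
    rfl
  unfold rankWeight
  rw [h]
  have := FiniteDimensional.span_of_finite K (Set.finite_range c)
  exact Submodule.finrank_map_le _ _

theorem rankWeight_add_le (K : Type*) [Field K] {L : Type*} [Field L] [Algebra K L]
    {n : ℕ} (b c : Fin n → L) : rankWeight K (b + c) ≤ rankWeight K b + rankWeight K c := by
  have := FiniteDimensional.span_of_finite K (Set.finite_range b)
  have := FiniteDimensional.span_of_finite K (Set.finite_range c)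
  refine le_trans (Submodule.finrank_mono ?_) (Submodule.finrank_add_le_finrank_add_finrank _ _)
  rw [Submodule.span_le]
  rintro _ ⟨i, rfl⟩
  exact Submodule.add_mem_sup (Submodule.subset_span ⟨i, rfl⟩) (Submodule.subset_span ⟨i, rfl⟩)

theorem rankWeight_ne_of_apply_eq_zero (K : Type*) [Field K] {L : Type*} [Field L] [Algebra K L]
    {n : ℕ} (c : Fin n → L) {i : Fin n} (hi : c i = 0) : rankWeight K c ≠ n := by
  intro h
  have hli : LinearIndependent K c := by
    rw [linearIndependent_iff_card_eq_finrank_span, Fintype.card_fin]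
    exact h.symm
  exact hli.ne_zero i hi

/-- For any `[n,2,d]` antipodal two-weight rank metric code over
`F_{q^m}/F_q`, the minimum rank distance `d` is at least `n/2`, i.e. `n ≤ 2d`. -/
theorem atw_min_dist_ge_half
    {K L : Type*} [Field K] [Fintype K] [Field L] [Algebra K L]
    {n d : ℕ}
    (C : Submodule L (Fin n → L)) (hdim : Module.finrank L C = 2)
    (hmin : ∀ c ∈ C, c ≠ 0 → d ≤ rankWeight K c)
    (hdex : ∃ c ∈ C, c ≠ 0 ∧ rankWeight K c = d)
    (hdn : d < n)
    (htw : ∀ c ∈ C, c ≠ 0 → rankWeight K c = d ∨ rankWeight K c = n)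
    (hfull : ∃ c ∈ C, rankWeight K c = n) :
    n ≤ 2 * d := by
  obtain ⟨c, hc, hc0, hcd⟩ := hdex
  obtain ⟨e, he, hen⟩ := hfull
  obtain ⟨i, hi⟩ := Function.ne_iff.mp hc0
  have hi' : c i ≠ 0 := hi
  set a : L := e i / c i with ha
  have hsmul : rankWeight K (a • c) ≤ d := hcd ▸ rankWeight_smul_le K a c
  have hzero : (e - a • c) i = 0 := by
    simp [ha, hi']
  have hne : e - a • c ≠ 0 := by
    intro h
    rw [sub_eq_zero] at h
    rw [← h] at hsmul
    omega
  have hrank := (htw _ (C.sub_mem he (C.smul_mem a hc)) hne).resolve_right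
    (rankWeight_ne_of_apply_eq_zero K _ hzero)
  have hadd := rankWeight_add_le K (e - a • c) (a • c)
  rw [sub_add_cancel] at hadd
  omega
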